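/- Let n, s, e, d, z be integers with n ≥ 5, s ≥ n-1, z = d - s(e+n+1-s) and z ≥ n-1. Assume at least one of the following holds: (i) d ≤ (s-2)(n-1+e)+1; (ii) z(e+n+1) ≤ (s-1)((s-1)^2 - z); (iii) e ≤ s-n-1. Then (n-1)(e+n-1) ≤ (s-1)((s-1)^2 - (n-1)). -/

import Mathlib

theorem stmt4 (n s e d z : ℤ)
    (hn : n ≥ 5) (hs : s ≥ n - 1)
    (hz : z = d - s * (e + n + 1 - s)) (hz' : z ≥ n - 1)
    (halt : d ≤ (s - 2) * (n - 1 + e) + 1 ∨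
            z * (e + n + 1) ≤ (s - 1) * ((s - 1) ^ 2 - z) ∨
            e ≤ s - n - 1) :
    (n - 1) * (e + n - 1) ≤ (s - 1) * ((s - 1) ^ 2 - (n - 1)) := by
  obtain ⟨m, rfl⟩ : ∃ m, n = m + 1 := ⟨n - 1, by ring⟩
  obtain ⟨t, rfl⟩ : ∃ t, s = t + 1 := ⟨s - 1, by ring⟩
  obtain ⟨E, rfl⟩ : ∃ E, e = E - m := ⟨e + m, by ring⟩
  have hm : 4 ≤ m := by linarith
  have hmt : m ≤ t + 1 := by linarith
  have ht : 3 ≤ t := by linarith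
  have hzm : m ≤ z := by linarith
  have ht3 : 0 ≤ t ^ 3 := by positivity
  suffices h : m * (E + t) ≤ t ^ 3 by
    ring_nf at h ⊢
    linarith
  rcases halt with h | h | h
  · have h1 : 2 * E ≤ t ^ 2 - m := by
      have : z ≤ t ^ 2 - 2 * E := by
        rw [hz]; ring_nf at h ⊢; linarith
      linarith
    have h2 : 0 ≤ t ^ 2 - m := by nlinarith
    have h3 : m * (2 * E) ≤ m * (t ^ 2 - m) :=
      mul_le_mul_of_nonneg_left h1 (by linarith)
    have h4 : m * (t ^ 2 - m) ≤ (2 * t) * (t ^ 2 - m) :=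
      mul_le_mul_of_nonneg_right (by linarith) h2
    nlinarith
  · have h1 : z * (E + 2 + t) ≤ t ^ 3 := by
      ring_nf at h ⊢; linarith
    by_cases h0 : 0 ≤ E + 2 + t
    · have := mul_le_mul_of_nonneg_right hzm h0
      nlinarith
    · nlinarith
  · have h1 : E + t ≤ 2 * t - 1 := by linarith
    have h2 : m * (E + t) ≤ m * (2 * t - 1) :=
      mul_le_mul_of_nonneg_left h1 (by linarith)
    have h3 : m * (2 * t - 1) ≤ (t + 1) * (2 * t - 1) :=
      mul_le_mul_of_nonneg_right hmt (by linarith)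
    have h4 : 3 * t ^ 2 ≤ t ^ 3 := by nlinarith [sq_nonneg t]
    nlinarith
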